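/- arXiv:0802.1231 — 3 statements merged into one kernel-verified Lean document; each statement's English description precedes it below -/
import Mathlib

section
/- Let n₁, n₂, d be positive integers and let b ∈ ℤ^d. Then f_{n₁,n₂}(b) = Σ_{k=0}^{n₂-1} Σ_{x ∈ {0,...,n₁n₂-1}^d} e_{n₁n₂}(b·x + n₁ k (x·x)) satisfies: if n₁ divides every coordinate of b then f_{n₁,n₂}(b) = n₁^d · f_{n₂}(c) where c = b/n₁ (coordinatewise), and if n₁ does not divide every coordinate of b then f_{n₁,n₂}(b) = 0. -/
open Finset

/-- `en n x = exp(2πi x / n)` -/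
noncomputable def en (n : ℕ) (x : ℤ) : ℂ := Complex.exp (2 * Real.pi * Complex.I * x / n)

/-- `f_n(b) = Σ_{k=0}^{n-1} Σ_{x ∈ {0,…,n-1}^d} e_n(b·x + k(x·x))`. -/
noncomputable def fsum (n d : ℕ) (b : Fin d → ℤ) : ℂ :=
  ∑ k ∈ Finset.range n, ∑ x ∈ Fintype.piFinset fun _ : Fin d => Finset.Ico (0:ℤ) n,
    en n (∑ i, b i * x i + k * ∑ i, x i ^ 2)

/-- `f_{n₁,n₂}(b) = Σ_{k=0}^{n₂-1} Σ_{x ∈ {0,…,n₁n₂-1}^d} e_{n₁n₂}(b·x + n₁k(x·x))`. -/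
noncomputable def fsum2 (n₁ n₂ d : ℕ) (b : Fin d → ℤ) : ℂ :=
  ∑ k ∈ Finset.range n₂, ∑ x ∈ Fintype.piFinset fun _ : Fin d => Finset.Ico (0:ℤ) (n₁ * n₂),
    en (n₁ * n₂) (∑ i, b i * x i + n₁ * k * ∑ i, x i ^ 2)

lemma en_add (n : ℕ) (x y : ℤ) : en n (x + y) = en n x * en n y := by
  rw [en, en, en, ← Complex.exp_add]
  congr 1
  push_cast
  ring

lemma en_sum {ι : Type*} (n : ℕ) (s : Finset ι) (g : ι → ℤ) :
    en n (∑ i ∈ s, g i) = ∏ i ∈ s, en n (g i) := by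
  simp only [en, ← Complex.exp_sum]
  congr 1
  push_cast
  rw [Finset.mul_sum, Finset.sum_div]

lemma en_nat_mul (n q : ℕ) (x : ℤ) : en n (q * x) = en n x ^ q := by
  rw [en, en, ← Complex.exp_nat_mul]
  congr 1
  push_cast
  ring

lemma en_eq_one_iff {n : ℕ} (hn : 0 < n) (x : ℤ) : en n x = 1 ↔ (n : ℤ) ∣ x := by
  have hn' : (n : ℂ) ≠ 0 := by exact_mod_cast hn.ne'
  rw [en, Complex.exp_eq_one_iff]
  refine exists_congr fun m => ?_
  have hpi := Complex.two_pi_I_ne_zero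
  rw [div_eq_iff hn', mul_comm (m : ℂ), mul_assoc (2 * Real.pi * Complex.I) (m : ℂ),
    mul_right_inj' hpi, mul_comm (m : ℂ)]
  exact_mod_cast Iff.rfl

lemma en_mul_mul_left {n : ℕ} (hn : 0 < n) (m : ℕ) (x : ℤ) : en (n * m) (n * x) = en m x := by
  have hn' : (n : ℂ) ≠ 0 := by exact_mod_cast hn.ne'
  rw [en, en]
  congr 1
  push_cast
  rw [mul_left_comm, mul_div_mul_left _ _ hn']

/-- A multidimensional quadratic exponential sum factors into one-dimensional ones. -/
lemma sum_piFinset_en {ι : Type*} [Fintype ι] [DecidableEq ι] (n : ℕ) (s : Finset ℤ)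
    (b : ι → ℤ) (a : ℤ) :
    ∑ x ∈ Fintype.piFinset fun _ : ι => s, en n (∑ i, b i * x i + a * ∑ i, x i ^ 2) =
      ∏ i, ∑ y ∈ s, en n (b i * y + a * y ^ 2) := by
  rw [Finset.prod_univ_sum]
  refine Finset.sum_congr rfl fun x _ => ?_
  rw [Finset.mul_sum, ← Finset.sum_add_distrib, en_sum]

lemma sum_Ico_zero_eq_sum_range (n : ℕ) (g : ℤ → ℂ) :
    ∑ x ∈ Finset.Ico (0 : ℤ) n, g x = ∑ x ∈ Finset.range n, g x := by
  refine (Finset.sum_bij (fun (x : ℕ) _ => (x : ℤ)) ?_ ?_ ?_ ?_).symm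
  · intro x hx
    simpa using hx
  · intro x _ y _ h
    exact_mod_cast h
  · intro y hy
    rw [Finset.mem_Ico] at hy
    exact ⟨y.toNat, by rw [Finset.mem_range]; omega, by omega⟩
  · intro x _
    rfl

/-- Summation over consecutive blocks of a function that is multiplied by `ω` when its argument is
shifted by the block length. -/
lemma sum_range_mul_of_quasiperiodic (m n : ℕ) (g : ℤ → ℂ) (ω : ℂ)
    (hg : ∀ (q : ℕ) (x : ℤ), g (n * q + x) = ω ^ q * g x) :
    ∑ x ∈ Finset.range (m * n), g x =
      (∑ q ∈ Finset.range m, ω ^ q) * ∑ x ∈ Finset.range n, g x := by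
  induction m with
  | zero => simp
  | succ m ih =>
    rw [Nat.succ_mul, Finset.sum_range_add, ih, Finset.sum_range_succ _ m, add_mul]
    congr 1
    rw [Finset.mul_sum]
    refine Finset.sum_congr rfl fun x _ => ?_
    rw [← hg]
    push_cast
    rw [mul_comm (m : ℤ)]

lemma en_quadratic_add {n₁ n₂ : ℕ} (h₁ : 0 < n₁) (h₂ : 0 < n₂) (b k : ℤ) (q : ℕ) (x : ℤ) :
    en (n₁ * n₂) (b * (n₂ * q + x) + n₁ * k * (n₂ * q + x) ^ 2) =
      en n₁ b ^ q * en (n₁ * n₂) (b * x + n₁ * k * x ^ 2) := by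
  have hsplit : b * (n₂ * q + x) + n₁ * k * (n₂ * q + x) ^ 2 =
      n₂ * (q * b) + (b * x + n₁ * k * x ^ 2) +
        (n₁ * n₂ : ℕ) * (k * (n₂ * q ^ 2 + 2 * q * x)) := by
    push_cast
    ring
  rw [hsplit, en_add, (en_eq_one_iff (Nat.mul_pos h₁ h₂) _).2 (dvd_mul_right _ _), mul_one, en_add,
    mul_comm n₁ n₂, en_mul_mul_left h₂, en_nat_mul]

lemma sum_en_quadratic {n₁ n₂ : ℕ} (h₁ : 0 < n₁) (h₂ : 0 < n₂) (b k : ℤ) :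
    ∑ y ∈ Finset.Ico (0 : ℤ) (n₁ * n₂), en (n₁ * n₂) (b * y + n₁ * k * y ^ 2) =
      (∑ q ∈ Finset.range n₁, en n₁ b ^ q) *
        ∑ y ∈ Finset.Ico (0 : ℤ) n₂, en (n₁ * n₂) (b * y + n₁ * k * y ^ 2) := by
  rw [← Nat.cast_mul, sum_Ico_zero_eq_sum_range, sum_Ico_zero_eq_sum_range]
  exact sum_range_mul_of_quasiperiodic n₁ n₂
    (fun y => en (n₁ * n₂) (b * y + n₁ * k * y ^ 2)) _ (en_quadratic_add h₁ h₂ b k)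

lemma sum_en_quadratic_of_dvd {n₁ n₂ : ℕ} (h₁ : 0 < n₁) (h₂ : 0 < n₂) {b : ℤ}
    (hb : (n₁ : ℤ) ∣ b) (k : ℤ) :
    ∑ y ∈ Finset.Ico (0 : ℤ) (n₁ * n₂), en (n₁ * n₂) (b * y + n₁ * k * y ^ 2) =
      n₁ * ∑ y ∈ Finset.Ico (0 : ℤ) n₂, en n₂ (b / n₁ * y + k * y ^ 2) := by
  rw [sum_en_quadratic h₁ h₂, (en_eq_one_iff h₁ b).2 hb]
  congr 1
  · simp
  · refine Finset.sum_congr rfl fun y _ => ?_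
    rw [← en_mul_mul_left h₁ n₂, mul_add, ← mul_assoc, ← mul_assoc, Int.mul_ediv_cancel' hb]

lemma sum_en_quadratic_of_not_dvd {n₁ n₂ : ℕ} (h₁ : 0 < n₁) (h₂ : 0 < n₂) {b : ℤ}
    (hb : ¬ (n₁ : ℤ) ∣ b) (k : ℤ) :
    ∑ y ∈ Finset.Ico (0 : ℤ) (n₁ * n₂), en (n₁ * n₂) (b * y + n₁ * k * y ^ 2) = 0 := by
  have hω : en n₁ b ^ n₁ = 1 := by
    rw [← en_nat_mul, en_eq_one_iff h₁]
    exact dvd_mul_right _ _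
  have hne : en n₁ b - 1 ≠ 0 := sub_ne_zero.2 fun h => hb ((en_eq_one_iff h₁ b).1 h)
  have hgeom : ∑ q ∈ Finset.range n₁, en n₁ b ^ q = 0 := by
    refine (mul_eq_zero.1 ?_).resolve_right hne
    rw [geom_sum_mul, hω, sub_self]
  rw [sum_en_quadratic h₁ h₂, hgeom, zero_mul]

/-- `f_{n₁,n₂}(b) = δ(n₁ ∣ b) n₁^d f_{n₂}(b / n₁)`. -/
theorem fsum2_eq (n₁ n₂ d : ℕ) (h₁ : 0 < n₁) (h₂ : 0 < n₂) (hd : 0 < d) (b : Fin d → ℤ) :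
    ((∀ i, (n₁ : ℤ) ∣ b i) → fsum2 n₁ n₂ d b = (n₁ : ℂ) ^ d * fsum n₂ d (fun i => b i / n₁)) ∧
    ((¬ ∀ i, (n₁ : ℤ) ∣ b i) → fsum2 n₁ n₂ d b = 0) := by
  simp only [fsum2, fsum, sum_piFinset_en]
  constructor
  · intro hb
    rw [Finset.mul_sum]
    refine Finset.sum_congr rfl fun k _ => ?_
    rw [Finset.prod_congr rfl fun i _ => sum_en_quadratic_of_dvd h₁ h₂ (hb i) k,
      Finset.prod_mul_distrib]
    simp
  · intro hb
    obtain ⟨i, hi⟩ := not_forall.1 hb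
    exact Finset.sum_eq_zero fun k _ =>
      Finset.prod_eq_zero (Finset.mem_univ i) (sum_en_quadratic_of_not_dvd h₁ h₂ hi k)
end

section
/- Let n be an odd positive integer, d an even positive integer, and b ∈ ℤ^d. Then g_n(b) = (G_n(1))^d · r(−b·b, n), i.e., Σ_{0 ≤ k < n, gcd(k,n)=1} Σ_{x ∈ {0,...,n-1}^d} e_n(b·x + k(x·x)) = (Σ_{k=0}^{n-1} e_n(k²))^d · Σ_{0 ≤ k < n, gcd(k,n)=1} e_n(−(b·b)k). -/
open Finset

/-- `g_n(b) = Σ_{0 ≤ k < n, gcd(k,n)=1} Σ_{x ∈ {0,…,n-1}^d} e_n(b·x + k(x·x))`. -/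
noncomputable def gsum (n d : ℕ) (b : Fin d → ℤ) : ℂ :=
  ∑ k ∈ (Finset.range n).filter (fun k => Nat.gcd k n = 1),
    ∑ x ∈ Fintype.piFinset fun _ : Fin d => Finset.Ico (0:ℤ) n,
      en n (∑ i, b i * x i + k * ∑ i, x i ^ 2)

/-- The Gauss sum `G_m(c) = Σ_{j=0}^{m-1} e_m(c j²)`. -/
noncomputable def gauss (m : ℕ) (c : ℤ) : ℂ := ∑ j ∈ Finset.range m, en m (c * j ^ 2)

/-- The Ramanujan sum `r(c, n) = Σ_{0 ≤ k < n, gcd(k,n)=1} e_n(kc)`. -/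
noncomputable def ram (c : ℤ) (n : ℕ) : ℂ :=
  ∑ k ∈ (Finset.range n).filter (fun k => Nat.gcd k n = 1), en n (k * c)

/-- `en` is the standard additive character of `ZMod n`. -/
theorem en_eq_stdAddChar (n : ℕ) [NeZero n] (x : ℤ) : en n x = ZMod.stdAddChar (x : ZMod n) := by
  rw [ZMod.stdAddChar_coe, en]

theorem sum_range_natCast_zmod {M : Type*} [AddCommMonoid M] (n : ℕ) [NeZero n] (f : ZMod n → M) :
    ∑ j ∈ Finset.range n, f j = ∑ x, f x := by
  refine Finset.sum_bij' (fun j _ => (j : ZMod n)) (fun x _ => x.val) (by simp)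
    (fun x _ => by simpa using ZMod.val_lt x) (fun j hj => ?_) (by simp) (by simp)
  exact ZMod.val_cast_of_lt (Finset.mem_range.mp hj)

theorem sum_Ico_intCast_zmod {M : Type*} [AddCommMonoid M] (n : ℕ) [NeZero n] (f : ZMod n → M) :
    ∑ j ∈ Finset.Ico (0 : ℤ) n, f j = ∑ x, f x := by
  rw [← sum_range_natCast_zmod]
  refine Finset.sum_bij' (fun j _ => j.toNat) (fun j _ => (j : ℤ)) ?_ ?_ ?_ ?_ ?_
  · intro j hj; simp at hj ⊢; omega
  · intro j hj; simp at hj ⊢; omega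
  · intro j hj; simp at hj ⊢; omega
  · simp
  · intro j hj
    have h : ((j.toNat : ℤ) : ZMod n) = j := by rw [Int.toNat_of_nonneg (by simp at hj; omega)]
    rw [← h, Int.cast_natCast]

theorem sum_coprime_natCast_zmod {M : Type*} [AddCommMonoid M] (n : ℕ) [NeZero n]
    (f : ZMod n → M) :
    ∑ k ∈ (Finset.range n).filter (fun k => Nat.gcd k n = 1), f k = ∑ u : (ZMod n)ˣ, f u := by
  symm
  refine Finset.sum_bij (fun u _ => (u : ZMod n).val) (fun u _ => ?_) (fun u _ v _ h => ?_)
    (fun k hk => ?_) (by simp)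
  · simpa [ZMod.val_lt] using ZMod.val_coe_unit_coprime u
  · exact Units.ext (ZMod.val_injective n h)
  · simp only [Finset.mem_filter, Finset.mem_range] at hk
    exact ⟨ZMod.unitOfCoprime k hk.2, Finset.mem_univ _, by simp [ZMod.val_cast_of_lt hk.1]⟩

/-- By Dirichlet's theorem, a unit modulo an odd number is represented by a prime that is `1`
modulo `4`, hence by a sum of two squares. -/
theorem exists_sq_add_sq_eq_unit {n : ℕ} (hn : Odd n) (u : (ZMod n)ˣ) :
    ∃ a c : ZMod n, a ^ 2 + c ^ 2 = u := by
  have : NeZero n := ⟨hn.pos.ne'⟩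
  have hcop : Nat.Coprime n 4 := (Nat.coprime_two_right.mpr hn).pow_right 2
  obtain ⟨m, hmn, hm4⟩ := Nat.chineseRemainder hcop (u : ZMod n).val 1
  have hm : Nat.Coprime m (n * 4) :=
    Nat.Coprime.mul_right (hmn.gcd_eq.trans (ZMod.val_coe_unit_coprime u))
      (hm4.gcd_eq.trans (by simp))
  have : NeZero (n * 4) := ⟨by have := hn.pos; omega⟩
  obtain ⟨p, -, hp, hpm⟩ := Nat.forall_exists_prime_gt_and_eq_mod
    ((ZMod.isUnit_iff_coprime m (n * 4)).mpr hm) 0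
  have hpm' := (ZMod.natCast_eq_natCast_iff _ _ _).mp hpm
  have hpn := (hpm'.of_mul_right 4).trans hmn
  have hp4 : p % 4 = 1 := (hpm'.of_mul_left n).trans hm4
  have := Fact.mk hp
  obtain ⟨a, c, h⟩ := Nat.Prime.sq_add_sq (p := p) (by omega)
  refine ⟨a, c, ?_⟩
  have := (ZMod.natCast_eq_natCast_iff _ _ _).mpr hpn
  rw [← h] at this
  simpa using this

theorem addChar_sum_eq_prod {A ι : Type*} [AddCommMonoid A] (ψ : AddChar A ℂ)
    (s : Finset ι) (f : ι → A) : ψ (∑ i ∈ s, f i) = ∏ i ∈ s, ψ (f i) :=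
  map_prod ψ.toMonoidHom (fun i => Multiplicative.ofAdd (f i)) s

/-- Squares of quadratic Gauss sums do not depend on the (unit) coefficient, since the binary
form `x² + y²` is equivalent to each of its multiples by a sum of two squares. -/
theorem sq_sum_addChar_unit_mul_sq {n : ℕ} [NeZero n] (hn : Odd n) (ψ : AddChar (ZMod n) ℂ)
    (u : (ZMod n)ˣ) : (∑ x, ψ (u * x ^ 2)) ^ 2 = (∑ x, ψ (x ^ 2)) ^ 2 := by
  obtain ⟨a, c, h⟩ := exists_sq_add_sq_eq_unit hn u
  have hu : (↑u⁻¹ : ZMod n) * (a ^ 2 + c ^ 2) = 1 := by rw [h]; simp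
  let e : ZMod n × ZMod n ≃ ZMod n × ZMod n :=
    { toFun := fun p => (a * p.1 - c * p.2, c * p.1 + a * p.2)
      invFun := fun p => (↑u⁻¹ * (a * p.1 + c * p.2), ↑u⁻¹ * (a * p.2 - c * p.1))
      left_inv := fun p => by
        ext
        · linear_combination p.1 * hu
        · linear_combination p.2 * hu
      right_inv := fun p => by
        ext
        · linear_combination p.1 * hu
        · linear_combination p.2 * hu }
  simp only [sq (∑ _, _), Finset.sum_mul_sum, ← AddChar.map_add_eq_mul, ← Fintype.sum_prod_type']
  refine Fintype.sum_equiv e _ _ fun p => congrArg ψ ?_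
  simp only [e, Equiv.coe_fn_mk]
  linear_combination (-p.1 ^ 2 - p.2 ^ 2) * h

/-- Completing the square, with `v` an inverse of `4 * u`. -/
theorem sum_addChar_linear_add_quadratic {n : ℕ} [NeZero n] (ψ : AddChar (ZMod n) ℂ)
    {u v : ZMod n} (huv : 4 * u * v = 1) (β : ZMod n) :
    ∑ x, ψ (β * x + u * x ^ 2) = ψ (-(β ^ 2 * v)) * ∑ x, ψ (u * x ^ 2) := by
  rw [Finset.mul_sum]
  refine Fintype.sum_equiv (Equiv.addRight (2 * v * β)) _ _ fun x => ?_
  rw [← AddChar.map_add_eq_mul]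
  congr 1
  simp only [Equiv.coe_addRight]
  linear_combination (-β * x - β ^ 2 * v) * huv

/-- For `n` odd and `d` even, `g_n(b) = (G_n(1))^d · r(−b·b, n)`. -/
theorem gsum_eq_gauss_pow_mul_ramanujan (n d : ℕ) (hn : 0 < n) (hnodd : Odd n)
    (hd : 0 < d) (hdeven : Even d) (b : Fin d → ℤ) :
    gsum n d b = (gauss n 1) ^ d * ram (-(∑ i, b i ^ 2)) n := by
  have : NeZero n := ⟨hn.ne'⟩
  let ψ : AddChar (ZMod n) ℂ := ZMod.stdAddChar
  have hgauss : gauss n 1 = ∑ x : ZMod n, ψ (x ^ 2) := by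
    rw [← sum_range_natCast_zmod, gauss]
    simp [en_eq_stdAddChar, ψ]
  have hram : ram (-(∑ i, b i ^ 2)) n =
      ∑ u : (ZMod n)ˣ, ψ (u * -∑ i, (b i : ZMod n) ^ 2) := by
    rw [← sum_coprime_natCast_zmod n fun k => ψ (k * -∑ i, (b i : ZMod n) ^ 2), ram]
    simp [en_eq_stdAddChar, ψ]
  have hgsum : gsum n d b =
      ∑ u : (ZMod n)ˣ, ∏ i, ∑ x : ZMod n, ψ (b i * x + u * x ^ 2) := by
    rw [← sum_coprime_natCast_zmod n fun k => ∏ i, ∑ x : ZMod n, ψ (b i * x + k * x ^ 2), gsum]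
    refine Finset.sum_congr rfl fun k _ => ?_
    simp only [← sum_Ico_intCast_zmod, Finset.prod_univ_sum]
    refine Finset.sum_congr rfl fun x _ => ?_
    rw [en_eq_stdAddChar, ← addChar_sum_eq_prod]
    simp [ψ, Finset.sum_add_distrib, Finset.mul_sum]
  obtain ⟨w, hw⟩ : IsUnit (4 : ZMod n) := by
    simpa using (ZMod.isUnit_iff_coprime 4 n).mpr
      ((Nat.coprime_two_left.mpr hnodd).pow_left 2)
  rw [hgsum, hgauss, hram, Finset.mul_sum]
  refine Fintype.sum_equiv ((Equiv.mulLeft w).trans (Equiv.inv _)) _ _ fun u => ?_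
  have huv : 4 * (u : ZMod n) * ↑(w * u)⁻¹ = 1 := by
    rw [← hw, ← Units.val_mul, Units.mul_inv]
  simp only [sum_addChar_linear_add_quadratic ψ huv, Finset.prod_mul_distrib, Finset.prod_const,
    Finset.card_univ, Fintype.card_fin]
  obtain ⟨m, rfl⟩ := even_iff_two_dvd.mp hdeven
  rw [pow_mul, sq_sum_addChar_unit_mul_sq hnodd, ← pow_mul, mul_comm, ← addChar_sum_eq_prod]
  congr 2
  simp [Finset.mul_sum, mul_comm]
end

section
/- For every odd positive integer n, every positive integer d, and every b ∈ ℤ^d, the quantity f_n(b) = Σ_{k=0}^{n-1} Σ_{x ∈ {0,...,n-1}^d} e_n(b·x + k(x·x)) is n times an integer, i.e., there exists m ∈ ℤ with f_n(b) = n·m. -/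
open Finset

/-- A sum of values of an additive character of `ZMod n` with values in the `n`-th cyclotomic field
is an integer if it ranges over a finite set on which the units of `ZMod n` act compatibly. -/
theorem exists_int_eq_sum_zmodChar {n : ℕ} [NeZero n] {K : Type*} [Field K] [Algebra ℚ K]
    [IsCyclotomicExtension {n} ℚ K] {ζ : K} (hζ : IsPrimitiveRoot ζ n) {M : Type*}
    [MulAction (ZMod n)ˣ M] (s : Finset M) (g : M → ZMod n)
    (hs : ∀ u : (ZMod n)ˣ, ∀ x ∈ s, u • x ∈ s) (hg : ∀ (u : (ZMod n)ˣ) (x), g (u • x) = u * g x) :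
    ∃ m : ℤ, ∑ x ∈ s, AddChar.zmodChar n hζ.pow_eq_one (g x) = m := by
  have := IsCyclotomicExtension.isGalois {n} ℚ K
  have := IsCyclotomicExtension.finiteDimensional {n} ℚ K
  set t : K := ∑ x ∈ s, AddChar.zmodChar n hζ.pow_eq_one (g x) with ht
  have hint : IsIntegral ℤ t := by
    refine IsIntegral.sum _ fun x _ => ?_
    rw [AddChar.zmodChar_apply]
    exact (hζ.isIntegral (NeZero.pos n)).pow _
  have hfix : ∀ σ : Gal(K/ℚ), σ t = t := by
    intro σ
    rw [ht, map_sum]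
    refine Finset.sum_nbij' (fun x => hζ.autToPow ℚ σ • x) (fun x => (hζ.autToPow ℚ σ)⁻¹ • x)
      (fun x hx => hs _ x hx) (fun x hx => hs _ x hx) (fun x _ => inv_smul_smul _ x)
      (fun x _ => smul_inv_smul _ x) fun x _ => ?_
    have hpow : AddChar.zmodChar n hζ.pow_eq_one ((hζ.autToPow ℚ σ : ZMod n) * g x) =
        ζ ^ ((hζ.autToPow ℚ σ : ZMod n).val * (g x).val) := by
      rw [← AddChar.zmodChar_apply' hζ.pow_eq_one]
      simp
    rw [hg, hpow, AddChar.zmodChar_apply, map_pow, pow_mul, hζ.autToPow_spec ℚ σ]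
  obtain ⟨q, hq⟩ := (IsGalois.mem_range_algebraMap_iff_fixed t).2 hfix
  rw [← hq, isIntegral_algebraMap_iff (algebraMap ℚ K).injective] at hint
  obtain ⟨m, rfl⟩ := IsIntegrallyClosed.isIntegral_iff.1 hint
  exact ⟨m, by simp [← hq]⟩

theorem exists_int_eq_sum_stdAddChar {n : ℕ} [NeZero n] {M : Type*} [MulAction (ZMod n)ˣ M]
    (s : Finset M) (g : M → ZMod n) (hs : ∀ u : (ZMod n)ˣ, ∀ x ∈ s, u • x ∈ s)
    (hg : ∀ (u : (ZMod n)ˣ) (x), g (u • x) = u * g x) :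
    ∃ m : ℤ, ∑ x ∈ s, ZMod.stdAddChar (g x) = (m : ℂ) := by
  let : Algebra ℚ (CyclotomicField n ℚ) := CyclotomicField.algebra n ℚ
  have : IsCyclotomicExtension {n} ℚ (CyclotomicField n ℚ) :=
    CyclotomicField.isCyclotomicExtension n ℚ
  let φ : CyclotomicField n ℚ →+* ℂ := Classical.arbitrary _
  have hξ := IsCyclotomicExtension.zeta_spec n ℚ (CyclotomicField n ℚ)
  have hω : IsPrimitiveRoot (Complex.exp (2 * Real.pi * Complex.I / n)) n :=
    Complex.isPrimitiveRoot_exp n (NeZero.ne n)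
  obtain ⟨i, -, hi⟩ :=
    (hξ.map_of_injective φ.injective).eq_pow_of_pow_eq_one hω.pow_eq_one
  rw [← map_pow] at hi
  have hζ := (hi ▸ hω).of_map_of_injective φ.injective
  obtain ⟨m, hm⟩ := exists_int_eq_sum_zmodChar hζ s g hs hg
  refine ⟨m, ?_⟩
  rw [← map_intCast φ, ← hm, map_sum]
  refine Finset.sum_congr rfl fun x _ => ?_
  rw [AddChar.zmodChar_apply, map_pow, hi, ← Complex.exp_nat_mul]
  have h := ZMod.stdAddChar_coe (N := n) ((g x).val : ℤ)
  rw [Int.cast_natCast, ZMod.natCast_zmod_val] at h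
  rw [h]
  congr 1
  push_cast
  ring

theorem sum_range_eq_sum_zmod {n : ℕ} [NeZero n] (F : ZMod n → ℂ) :
    ∑ k ∈ range n, F k = ∑ k, F k := by
  refine Finset.sum_nbij' (fun k => (k : ZMod n)) ZMod.val (by simp) ?_ ?_ (by simp) (by simp)
  · intro k _
    simpa using ZMod.val_lt k
  · intro k hk
    exact ZMod.val_cast_of_lt (mem_range.1 hk)

theorem sum_piFinset_Ico_eq_sum_zmod {n d : ℕ} [NeZero n] (F : (Fin d → ZMod n) → ℂ) :
    ∑ x ∈ Fintype.piFinset fun _ : Fin d => Ico (0 : ℤ) n, F (fun i => (x i : ZMod n)) =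
      ∑ y, F y := by
  refine Finset.sum_nbij' (fun x i => (x i : ZMod n)) (fun y i => ((y i).val : ℤ)) (by simp) ?_ ?_
    (by simp) (by simp)
  · intro y _
    simp only [Fintype.mem_piFinset, mem_Ico]
    exact fun i => ⟨by positivity, by exact_mod_cast ZMod.val_lt (y i)⟩
  · intro x hx
    ext i
    have hxi := mem_Ico.1 (Fintype.mem_piFinset.1 hx i)
    rw [ZMod.natCast_val, ZMod.coe_intCast, Int.emod_eq_of_lt hxi.1 hxi.2]

theorem fsum_eq_mul_sum_filter {n d : ℕ} [NeZero n] (b : Fin d → ℤ) :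
    fsum n d b = n * ∑ y : Fin d → ZMod n with ∑ i, y i ^ 2 = 0,
      ZMod.stdAddChar (∑ i, (b i : ZMod n) * y i) := by
  have hen (k : ℕ) (x : Fin d → ℤ) : en n (∑ i, b i * x i + k * ∑ i, x i ^ 2) =
      ZMod.stdAddChar (∑ i, (b i : ZMod n) * (x i : ZMod n) +
        (k : ZMod n) * ∑ i, (x i : ZMod n) ^ 2) := by
    rw [en, ← ZMod.stdAddChar_coe]
    push_cast
    rfl
  simp_rw [fsum, hen]
  have hsum (k : ℕ) := sum_piFinset_Ico_eq_sum_zmod (fun y : Fin d → ZMod n =>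
    (ZMod.stdAddChar (∑ i, (b i : ZMod n) * y i + (k : ZMod n) * ∑ i, y i ^ 2) : ℂ))
  simp_rw [hsum]
  rw [sum_range_eq_sum_zmod (fun k => ∑ y : Fin d → ZMod n,
    (ZMod.stdAddChar (∑ i, (b i : ZMod n) * y i + k * ∑ i, y i ^ 2) : ℂ)), sum_comm, sum_filter,
    mul_sum]
  refine sum_congr rfl fun y _ => ?_
  simp_rw [AddChar.map_add_eq_mul]
  rw [← mul_sum, AddChar.sum_mulShift _ (ZMod.isPrimitive_stdAddChar n), ZMod.card]
  split_ifs <;> simp [mul_comm]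

/-- For `n` odd, `n ∣ f_n(b)`. -/
theorem fsum_div_odd (n d : ℕ) (hn : 0 < n) (hnodd : Odd n) (hd : 0 < d) (b : Fin d → ℤ) :
    ∃ m : ℤ, fsum n d b = n * m := by
  have : NeZero n := ⟨hn.ne'⟩
  obtain ⟨m, hm⟩ := exists_int_eq_sum_stdAddChar
    {y : Fin d → ZMod n | ∑ i, y i ^ 2 = 0} (fun y => ∑ i, (b i : ZMod n) * y i)
    (fun u y hy => by
      simp only [mem_filter_univ, Pi.smul_apply, Units.smul_def, smul_eq_mul, mul_pow] at hy ⊢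
      rw [← mul_sum, hy, mul_zero])
    (fun u y => by
      simp only [Pi.smul_apply, Units.smul_def, smul_eq_mul, mul_sum, mul_left_comm])
  exact ⟨m, by rw [fsum_eq_mul_sum_filter, hm]⟩
end
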